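/- arXiv:0803.2074 — 5 statements merged into one kernel-verified Lean document; each statement's English description precedes it below -/
import Mathlib

section
/- Let m be a positive integer and let σ be the ℝ-algebra automorphism of the polynomial ring ℝ[x, y] determined by σ(x) = cos(2π/m)·x − sin(2π/m)·y and σ(y) = sin(2π/m)·x + cos(2π/m)·y. Let u, v ∈ ℝ[x, y] be the unique polynomials with u(x, y) + i·v(x, y) = (x + iy)^m (i.e. u and v are the real and imaginary parts of (x + iy)^m as a polynomial identity), and let w = x² + y². Then a polynomial P ∈ ℝ[x, y] satisfies σ(P) = P if and only if P lies in the ℝ-subalgebra of ℝ[x, y] generated by u, v and w. -/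
open MvPolynomial Real

namespace RotationInvariants

theorem map_add_I_mul_map_injective {ι : Type*} {p q p' q' : MvPolynomial ι ℝ}
    (h : map (algebraMap ℝ ℂ) p + C Complex.I * map (algebraMap ℝ ℂ) q
      = map (algebraMap ℝ ℂ) p' + C Complex.I * map (algebraMap ℝ ℂ) q') :
    p = p' ∧ q = q' := by
  have key (s : ι →₀ ℕ) : p.coeff s = p'.coeff s ∧ q.coeff s = q'.coeff s := by
    have hs := congrArg (coeff s) h
    simp only [coeff_add, coeff_C_mul, coeff_map, Complex.coe_algebraMap] at hs
    exact ⟨by simpa using congrArg Complex.re hs, by simpa using congrArg Complex.im hs⟩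
  exact ⟨MvPolynomial.ext _ _ fun s => (key s).1, MvPolynomial.ext _ _ fun s => (key s).2⟩

theorem C_I_mul_C_I {ι : Type*} : (C Complex.I * C Complex.I : MvPolynomial ι ℂ) = -1 := by
  rw [← C_mul, Complex.I_mul_I, C_neg, C_1]

/-- Elements of the complexification of a real subalgebra have real and imaginary parts in it. -/
theorem exists_of_mem_adjoin_map {ι : Type*} (S : Subalgebra ℝ (MvPolynomial ι ℝ))
    {f : MvPolynomial ι ℂ}
    (hf : f ∈ Algebra.adjoin ℂ (map (algebraMap ℝ ℂ) '' (S : Set (MvPolynomial ι ℝ)))) :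
    ∃ p ∈ S, ∃ q ∈ S,
      f = map (algebraMap ℝ ℂ) p + C Complex.I * map (algebraMap ℝ ℂ) q := by
  induction hf using Algebra.adjoin_induction with
  | mem x hx =>
    obtain ⟨p, hp, rfl⟩ := hx
    exact ⟨p, hp, 0, S.zero_mem, by simp⟩
  | algebraMap r =>
    refine ⟨C r.re, S.algebraMap_mem r.re, C r.im, S.algebraMap_mem r.im, ?_⟩
    rw [map_C, map_C, ← C_mul, ← C_add, MvPolynomial.algebraMap_eq]
    congr 1
    simp [mul_comm Complex.I, Complex.re_add_im]
  | add x y _ _ hx hy =>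
    obtain ⟨p, hp, q, hq, rfl⟩ := hx
    obtain ⟨p', hp', q', hq', rfl⟩ := hy
    exact ⟨p + p', S.add_mem hp hp', q + q', S.add_mem hq hq', by simp only [map_add]; ring⟩
  | mul x y _ _ hx hy =>
    obtain ⟨p, hp, q, hq, rfl⟩ := hx
    obtain ⟨p', hp', q', hq', rfl⟩ := hy
    refine ⟨p * p' - q * q', S.sub_mem (S.mul_mem hp hp') (S.mul_mem hq hq'),
      p * q' + q * p', S.add_mem (S.mul_mem hp hq') (S.mul_mem hq hp'), ?_⟩
    simp only [map_add, map_sub, map_mul]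
    linear_combination map (algebraMap ℝ ℂ) q * map (algebraMap ℝ ℂ) q' * C_I_mul_C_I (ι := ι)

/-- Coefficients of a polynomial after rescaling the variables. -/
theorem coeff_aeval_C_mul_X {ι R : Type*} [CommRing R] (a : ι → R) (g : MvPolynomial ι R)
    (s : ι →₀ ℕ) :
    coeff s (aeval (fun i => C (a i) * X i) g) = (s.prod fun i n => a i ^ n) * coeff s g := by
  classical
  induction g using MvPolynomial.induction_on' with
  | monomial t c =>
    have h : aeval (fun i => C (a i) * X i) (monomial t c)
        = monomial t (c * t.prod fun i n => a i ^ n) := by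
      rw [aeval_monomial, MvPolynomial.algebraMap_eq, monomial_eq, C_mul, mul_assoc]
      simp only [mul_pow, Finsupp.prod, Finset.prod_mul_distrib, map_prod, map_pow]
    rw [h, coeff_monomial, coeff_monomial]
    split_ifs with hts
    · subst hts; ring
    · simp
  | add p q hp hq => rw [map_add, coeff_add, hp, hq, coeff_add, mul_add]

/-- Monomials in `z` and `z'` of weight zero for a primitive `m`-th root of unity are generated by
`z ^ m`, `z' ^ m` and `z * z'`. -/
theorem pow_mul_pow_mem {R A : Type*} [CommSemiring R] [CommSemiring A] [Algebra R A]
    (T : Subalgebra R A) {K : Type*} [Field K] {ζ : K} {m : ℕ} (hζ : IsPrimitiveRoot ζ m)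
    (hm : 0 < m) {z z' : A} (hz : z ^ m ∈ T) (hz' : z' ^ m ∈ T) (hzz' : z * z' ∈ T) {a b : ℕ}
    (hab : ζ ^ a * ζ⁻¹ ^ b = 1) : z ^ a * z' ^ b ∈ T := by
  have h0 : ζ ≠ 0 := hζ.ne_zero hm.ne'
  have h1 : ζ ^ a = ζ ^ b := by
    rwa [inv_pow, mul_inv_eq_one₀ (pow_ne_zero b h0)] at hab
  rcases le_total b a with h | h
  · obtain ⟨d, rfl⟩ := Nat.exists_eq_add_of_le h
    rw [pow_add, mul_eq_left₀ (pow_ne_zero b h0)] at h1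
    obtain ⟨k, rfl⟩ := hζ.dvd_of_pow_eq_one _ h1
    have e : z ^ (b + m * k) * z' ^ b = (z * z') ^ b * (z ^ m) ^ k := by ring
    exact e ▸ T.mul_mem (T.pow_mem hzz' b) (T.pow_mem hz k)
  · obtain ⟨d, rfl⟩ := Nat.exists_eq_add_of_le h
    rw [pow_add, left_eq_mul₀ (pow_ne_zero a h0)] at h1
    obtain ⟨k, rfl⟩ := hζ.dvd_of_pow_eq_one _ h1
    have e : z ^ a * z' ^ (a + m * k) = (z * z') ^ a * (z' ^ m) ^ k := by ring
    exact e ▸ T.mul_mem (T.pow_mem hzz' a) (T.pow_mem hz' k)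

theorem conj_pow_eq {u v : MvPolynomial (Fin 2) ℝ} {m : ℕ}
    (huv : map (algebraMap ℝ ℂ) u + C Complex.I * map (algebraMap ℝ ℂ) v
      = (X 0 + C Complex.I * X 1) ^ m) :
    (X 0 - C Complex.I * X 1) ^ m
      = map (algebraMap ℝ ℂ) u - C Complex.I * map (algebraMap ℝ ℂ) v := by
  have hc : (starRingEnd ℂ).comp (algebraMap ℝ ℂ) = algebraMap ℝ ℂ := by ext; simp
  have h := congrArg (map (starRingEnd ℂ)) huv
  simp only [map_add, map_mul, map_pow, map_map, hc, map_C, map_X, Complex.conj_I, map_neg] at h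
  linear_combination -h

/-- The rotation by `c + i s`, acting on complex polynomials. -/
noncomputable def rotation (c s : ℝ) : MvPolynomial (Fin 2) ℂ →ₐ[ℂ] MvPolynomial (Fin 2) ℂ :=
  aeval ![C (c : ℂ) * X 0 - C (s : ℂ) * X 1, C (s : ℂ) * X 0 + C (c : ℂ) * X 1]

theorem rotation_map {c s : ℝ} (σ : MvPolynomial (Fin 2) ℝ →ₐ[ℝ] MvPolynomial (Fin 2) ℝ)
    (hσx : σ (X 0) = C c * X 0 - C s * X 1) (hσy : σ (X 1) = C s * X 0 + C c * X 1)
    (P : MvPolynomial (Fin 2) ℝ) :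
    rotation c s (map (algebraMap ℝ ℂ) P) = map (algebraMap ℝ ℂ) (σ P) := by
  induction P using MvPolynomial.induction_on with
  | C a =>
    rw [← MvPolynomial.algebraMap_eq, AlgHom.commutes, MvPolynomial.algebraMap_eq, map_C,
      ← MvPolynomial.algebraMap_eq, AlgHom.commutes]
  | add p q hp hq => simp only [map_add, hp, hq]
  | mul_X p i hp =>
    simp only [map_mul, hp, map_X]
    congr 1
    fin_cases i
    · simp [rotation, hσx]
    · simp [rotation, hσy]

theorem rotation_X_add (c s : ℝ) :
    rotation c s (X 0 + C Complex.I * X 1)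
      = C (c + s * Complex.I) * (X 0 + C Complex.I * X 1) := by
  have hC : rotation c s (C Complex.I) = C Complex.I := (rotation c s).commutes _
  rw [map_add, map_mul, hC]
  simp only [rotation, aeval_X, Matrix.cons_val_zero, Matrix.cons_val_one, C_add, C_mul]
  linear_combination -(C (s : ℂ) * X 1) * C_I_mul_C_I (ι := Fin 2)

/-- Substitution of `(z + z') / 2` for `x` and `(z - z') / 2i` for `y`. -/
noncomputable def toEigen : MvPolynomial (Fin 2) ℂ →ₐ[ℂ] MvPolynomial (Fin 2) ℂ :=
  aeval ![C (1 / 2) * (X 0 + X 1), C (-Complex.I / 2) * (X 0 - X 1)]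

/-- Substitution of `x + iy` for `z` and `x - iy` for `z'`. -/
noncomputable def ofEigen : MvPolynomial (Fin 2) ℂ →ₐ[ℂ] MvPolynomial (Fin 2) ℂ :=
  aeval ![X 0 + C Complex.I * X 1, X 0 - C Complex.I * X 1]

theorem ofEigen_C (a : ℂ) : ofEigen (C a) = C a := ofEigen.commutes a

theorem toEigen_C (a : ℂ) : toEigen (C a) = C a := toEigen.commutes a

theorem two_mul_C_half : (2 * C (1 / 2) : MvPolynomial (Fin 2) ℂ) = 1 := by
  rw [show (2 : MvPolynomial (Fin 2) ℂ) = C 2 from rfl, ← C_mul]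
  norm_num

theorem C_neg_I_div_two :
    (C (-Complex.I / 2) : MvPolynomial (Fin 2) ℂ) = -C Complex.I * C (1 / 2) := by
  rw [← C_neg, ← C_mul]
  ring_nf

theorem ofEigen_toEigen (f : MvPolynomial (Fin 2) ℂ) : ofEigen (toEigen f) = f := by
  suffices h : ofEigen.comp toEigen = AlgHom.id ℂ _ from DFunLike.congr_fun h f
  ext1 i
  fin_cases i
  · simp only [toEigen, AlgHom.comp_apply, Fin.zero_eta, aeval_X, Matrix.cons_val_zero, map_mul,
      map_add, ofEigen_C, AlgHom.id_apply]
    simp only [ofEigen, aeval_X, Matrix.cons_val_zero, Matrix.cons_val_one]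
    linear_combination X 0 * two_mul_C_half
  · simp only [toEigen, AlgHom.comp_apply, Fin.mk_one, aeval_X, Matrix.cons_val_one,
      Matrix.cons_val_zero, map_mul, map_neg,
      map_sub, ofEigen_C, AlgHom.id_apply, C_neg_I_div_two]
    simp only [ofEigen, aeval_X, Matrix.cons_val_zero, Matrix.cons_val_one]
    linear_combination X 1 * two_mul_C_half
      - X 1 * (2 * C (1 / 2)) * C_I_mul_C_I (ι := Fin 2)

theorem toEigen_rotation (c s : ℝ) (f : MvPolynomial (Fin 2) ℂ) :
    toEigen (rotation c s f)
      = aeval (fun i => C ((![c + s * Complex.I, c - s * Complex.I] : Fin 2 → ℂ) i) * X i)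
        (toEigen f) := by
  set δ : MvPolynomial (Fin 2) ℂ →ₐ[ℂ] MvPolynomial (Fin 2) ℂ :=
    aeval (fun i => C ((![c + s * Complex.I, c - s * Complex.I] : Fin 2 → ℂ) i) * X i) with hδ
  have hδC (a : ℂ) : δ (C a) = C a := δ.commutes a
  suffices h : toEigen.comp (rotation c s) = δ.comp toEigen from DFunLike.congr_fun h f
  ext1 i
  fin_cases i
  · simp only [rotation, AlgHom.comp_apply, Fin.zero_eta, aeval_X, Matrix.cons_val_zero, map_mul,
      map_sub, toEigen_C]
    simp only [toEigen, aeval_X, Matrix.cons_val_zero, Matrix.cons_val_one, map_mul, map_add, hδC,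
      C_neg_I_div_two]
    simp only [hδ, aeval_X, Matrix.cons_val_zero, Matrix.cons_val_one, C_add, C_sub, C_mul]
    ring
  · simp only [rotation, AlgHom.comp_apply, Fin.mk_one, aeval_X, Matrix.cons_val_one,
      Matrix.cons_val_zero, map_mul,
      map_add, toEigen_C]
    simp only [toEigen, aeval_X, Matrix.cons_val_zero, Matrix.cons_val_one, map_mul, map_sub, map_neg, hδC,
      C_neg_I_div_two]
    simp only [hδ, aeval_X, Matrix.cons_val_zero, Matrix.cons_val_one, C_add, C_sub, C_mul]
    linear_combination (C (s : ℂ) * C (1 / 2) * (X 0 + X 1)) * C_I_mul_C_I (ι := Fin 2)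

theorem isPrimitiveRoot_cos_add_sin {m : ℕ} (hm : 0 < m) :
    IsPrimitiveRoot
      ((Real.cos (2 * π / m) : ℂ) + (Real.sin (2 * π / m) : ℂ) * Complex.I) m := by
  convert Complex.isPrimitiveRoot_exp m hm.ne' using 1
  rw [Complex.ofReal_cos, Complex.ofReal_sin, ← Complex.exp_mul_I]
  congr 1
  push_cast
  ring

end RotationInvariants

open RotationInvariants

/-- Let `σ` be the `ℝ`-algebra automorphism of `ℝ[x,y]` given by rotation by angle
`2π/m`, let `u, v` be the real and imaginary parts of `(x + iy)^m` (as polynomials)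
and `w = x² + y²`. A polynomial `P` is `σ`-invariant iff it lies in the `ℝ`-subalgebra
generated by `u`, `v` and `w`. -/
theorem stmt_8 (m : ℕ) (hm : 0 < m)
    (σ : MvPolynomial (Fin 2) ℝ ≃ₐ[ℝ] MvPolynomial (Fin 2) ℝ)
    (hσx : σ (X 0) = C (Real.cos (2 * π / m)) * X 0 - C (Real.sin (2 * π / m)) * X 1)
    (hσy : σ (X 1) = C (Real.sin (2 * π / m)) * X 0 + C (Real.cos (2 * π / m)) * X 1)
    (u v : MvPolynomial (Fin 2) ℝ)
    (huv : MvPolynomial.map (algebraMap ℝ ℂ) u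
        + C Complex.I * MvPolynomial.map (algebraMap ℝ ℂ) v
        = (X 0 + C Complex.I * X 1) ^ m)
    (w : MvPolynomial (Fin 2) ℝ) (hw : w = X 0 ^ 2 + X 1 ^ 2) :
    ∀ P : MvPolynomial (Fin 2) ℝ,
      σ P = P ↔ P ∈ Algebra.adjoin ℝ ({u, v, w} : Set (MvPolynomial (Fin 2) ℝ)) := by
  have hcs := Real.cos_sq_add_sin_sq (2 * π / m)
  have hζ := isPrimitiveRoot_cos_add_sin hm
  set c := Real.cos (2 * π / m)
  set s := Real.sin (2 * π / m)
  have hrot := rotation_map (σ : MvPolynomial (Fin 2) ℝ →ₐ[ℝ] MvPolynomial (Fin 2) ℝ) hσx hσy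
  simp only [AlgEquiv.coe_toAlgHom] at hrot
  intro P
  constructor
  · intro hP
    set S := Algebra.adjoin ℝ ({u, v, w} : Set (MvPolynomial (Fin 2) ℝ))
    set T := Algebra.adjoin ℂ (map (algebraMap ℝ ℂ) '' (S : Set (MvPolynomial (Fin 2) ℝ)))
    have hT {p : MvPolynomial (Fin 2) ℝ} (hp : p ∈ ({u, v, w} : Set (MvPolynomial (Fin 2) ℝ))) :
        map (algebraMap ℝ ℂ) p ∈ T :=
      Algebra.subset_adjoin ⟨p, Algebra.subset_adjoin hp, rfl⟩
    have hu := hT (p := u) (by simp)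
    have hv : C Complex.I * map (algebraMap ℝ ℂ) v ∈ T :=
      T.mul_mem (T.algebraMap_mem _) (hT (by simp))
    have hz : (X 0 + C Complex.I * X 1) ^ m ∈ T := huv ▸ T.add_mem hu hv
    have hz' : (X 0 - C Complex.I * X 1) ^ m ∈ T := conj_pow_eq huv ▸ T.sub_mem hu hv
    have hzz' : (X 0 + C Complex.I * X 1) * (X 0 - C Complex.I * X 1) ∈ T := by
      convert hT (p := w) (by simp) using 1
      simp only [hw, map_add, map_pow, map_X]
      linear_combination -(X 1 ^ 2) * C_I_mul_C_I (ι := Fin 2)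
    have hinv : (c : ℂ) - s * Complex.I = (c + s * Complex.I)⁻¹ := by
      refine eq_inv_of_mul_eq_one_left ?_
      have hcs' : (c : ℂ) ^ 2 + (s : ℂ) ^ 2 = 1 := mod_cast hcs
      linear_combination hcs' - (s : ℂ) ^ 2 * Complex.I_mul_I
    set g := toEigen (map (algebraMap ℝ ℂ) P) with hg
    have hfix := toEigen_rotation c s (map (algebraMap ℝ ℂ) P)
    rw [hrot, hP, ← hg] at hfix
    have hPT : map (algebraMap ℝ ℂ) P ∈ T := by
      rw [← ofEigen_toEigen (map (algebraMap ℝ ℂ) P), ← hg, g.as_sum, map_sum]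
      refine T.sum_mem fun t ht => ?_
      rw [ofEigen, aeval_monomial]
      refine T.mul_mem (T.algebraMap_mem _) ?_
      have hcoeff := congrArg (coeff t) hfix
      rw [coeff_aeval_C_mul_X, eq_comm, mul_eq_right₀ (mem_support_iff.mp ht),
        Finsupp.prod_fintype _ _ (by simp), Fin.prod_univ_two] at hcoeff
      rw [Finsupp.prod_fintype _ _ (by simp), Fin.prod_univ_two]
      simp only [Matrix.cons_val_zero, Matrix.cons_val_one, hinv] at hcoeff ⊢
      exact pow_mul_pow_mem T hζ hm hz hz' hzz' hcoeff
    obtain ⟨p, hp, q, -, h⟩ := exists_of_mem_adjoin_map S hPT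
    have h' : map (algebraMap ℝ ℂ) P + C Complex.I * map (algebraMap ℝ ℂ) 0
        = map (algebraMap ℝ ℂ) p + C Complex.I * map (algebraMap ℝ ℂ) q := by
      simpa using h
    exact (map_add_I_mul_map_injective h').1 ▸ hp
  · intro hP
    have huv' : σ u = u ∧ σ v = v := by
      apply map_add_I_mul_map_injective
      have hC : rotation c s (C Complex.I) = C Complex.I := (rotation c s).commutes _
      have h := congrArg (rotation c s) huv
      rw [map_pow, rotation_X_add, mul_pow, ← C_pow, hζ.pow_eq_one, C_1, one_mul, ← huv, map_add,
        map_mul, hC, hrot, hrot] at h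
      exact h
    have hw' : σ w = w := by
      have hcsC : (C c ^ 2 + C s ^ 2 : MvPolynomial (Fin 2) ℝ) = 1 := by
        rw [← C_pow, ← C_pow, ← C_add, hcs, C_1]
      rw [hw, map_add, map_pow, map_pow, hσx, hσy]
      linear_combination (X 0 ^ 2 + X 1 ^ 2) * hcsC
    have hle : Algebra.adjoin ℝ ({u, v, w} : Set (MvPolynomial (Fin 2) ℝ))
        ≤ AlgHom.equalizer (σ : MvPolynomial (Fin 2) ℝ →ₐ[ℝ] MvPolynomial (Fin 2) ℝ)
          (AlgHom.id ℝ _) := by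
      refine Algebra.adjoin_le ?_
      rintro x (rfl | rfl | rfl)
      exacts [huv'.1, huv'.2, hw']
    exact hle hP
end

section
/- Consider the eight points P₁ = (1,1,1), P₂ = (1,−1,1), P₃ = (−1,1,1), P₄ = (−1,−1,1), P₅ = (2,2,1), P₆ = (−2,2,1), P₇ = (1,0,1), P₈ = (−1,0,1) in ℝ³, and the homogeneous cubic polynomials x₀ = (u² − v²)·v and x₁ = (u² − t²)·(v − 2t) in ℝ[u, v, t]. Then the ℝ-vector space of homogeneous polynomials of degree 3 in ℝ[u, v, t] vanishing at all eight points Pᵢ is two-dimensional, spanned by x₀ and x₁. -/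
open MvPolynomial

theorem MvPolynomial.IsHomogeneous.eq_sum_antidiagonalTuple {R : Type*} [CommSemiring R]
    {m n : ℕ} {p : MvPolynomial (Fin m) R} (hp : p.IsHomogeneous n) :
    p = ∑ k ∈ Finset.Nat.antidiagonalTuple m n,
      C (coeff (Finsupp.equivFunOnFinite.symm k) p) * ∏ i, X i ^ k i := by
  have hmon : ∀ k : Fin m → ℕ, C (coeff (Finsupp.equivFunOnFinite.symm k) p) * ∏ i, X i ^ k i =
      monomial (Finsupp.equivFunOnFinite.symm k) (coeff (Finsupp.equivFunOnFinite.symm k) p) := by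
    intro k
    rw [monomial_eq, Finsupp.prod_fintype _ _ (fun i => pow_zero _)]
    rfl
  simp_rw [hmon]
  ext d
  rw [coeff_sum]
  simp_rw [coeff_monomial]
  have hd : ∀ k : Fin m → ℕ, Finsupp.equivFunOnFinite.symm k = d ↔ k = d := by
    intro k
    rw [Equiv.symm_apply_eq]
    rfl
  simp_rw [hd]
  rw [Finset.sum_ite_eq']
  split_ifs with h
  · congr 1
    ext i
    rfl
  · refine hp.coeff_eq_zero ?_
    rwa [Finset.Nat.mem_antidiagonalTuple, ← Finsupp.degree_eq_sum] at h

theorem MvPolynomial.IsHomogeneous.exists_ternary_cubic {R : Type*} [CommSemiring R]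
    {p : MvPolynomial (Fin 3) R} (hp : p.IsHomogeneous 3) :
    ∃ a b c d e f g h i j : R, p = C a * X 0 ^ 3 + C b * X 0 ^ 2 * X 1 + C c * X 0 ^ 2 * X 2 +
      C d * X 0 * X 1 ^ 2 + C e * X 0 * X 1 * X 2 + C f * X 0 * X 2 ^ 2 + C g * X 1 ^ 3 +
      C h * X 1 ^ 2 * X 2 + C i * X 1 * X 2 ^ 2 + C j * X 2 ^ 3 := by
  have hs : Finset.Nat.antidiagonalTuple 3 3 = {![3, 0, 0], ![2, 1, 0], ![2, 0, 1], ![1, 2, 0],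
      ![1, 1, 1], ![1, 0, 2], ![0, 3, 0], ![0, 2, 1], ![0, 1, 2], ![0, 0, 3]} := by decide
  have key := hp.eq_sum_antidiagonalTuple
  rw [hs] at key
  repeat rw [Finset.sum_insert (by decide)] at key
  rw [Finset.sum_singleton] at key
  let c : (Fin 3 → ℕ) → R := fun k => coeff (Finsupp.equivFunOnFinite.symm k) p
  refine ⟨c ![3, 0, 0], c ![2, 1, 0], c ![2, 0, 1], c ![1, 2, 0], c ![1, 1, 1], c ![1, 0, 2],
    c ![0, 3, 0], c ![0, 2, 1], c ![0, 1, 2], c ![0, 0, 3], key.trans ?_⟩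
  simp only [Fin.prod_univ_three, Matrix.cons_val, pow_zero, pow_one, mul_one, one_mul, c]
  ring

/-- The space of homogeneous cubics in `ℝ[u,v,t]` vanishing at the eight points
`(±1,±1,1), (2,2,1), (−2,2,1), (±1,0,1)` is two-dimensional, spanned by
`x₀ = (u² − v²)v` and `x₁ = (u² − t²)(v − 2t)`. -/
theorem stmt_10 (pts : Fin 8 → (Fin 3 → ℝ))
    (hpts : pts = ![![1, 1, 1], ![1, -1, 1], ![-1, 1, 1], ![-1, -1, 1],
      ![2, 2, 1], ![-2, 2, 1], ![1, 0, 1], ![-1, 0, 1]])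
    (x₀ x₁ : MvPolynomial (Fin 3) ℝ)
    (hx₀ : x₀ = (X 0 ^ 2 - X 1 ^ 2) * X 1)
    (hx₁ : x₁ = (X 0 ^ 2 - X 2 ^ 2) * (X 1 - 2 * X 2))
    (W : Submodule ℝ (MvPolynomial (Fin 3) ℝ))
    (hW : W = homogeneousSubmodule (Fin 3) ℝ 3 ⊓
      ⨅ i : Fin 8, LinearMap.ker (MvPolynomial.aeval (pts i)).toLinearMap) :
    W = Submodule.span ℝ ({x₀, x₁} : Set (MvPolynomial (Fin 3) ℝ))
      ∧ Module.finrank ℝ W = 2 := by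
  have hmem : ∀ p, p ∈ W ↔ p.IsHomogeneous 3 ∧ ∀ i, aeval (pts i) p = 0 := by
    intro p
    simp [hW, Submodule.mem_iInf, mem_homogeneousSubmodule]
  have hspan : W = Submodule.span ℝ ({x₀, x₁} : Set (MvPolynomial (Fin 3) ℝ)) := by
    apply le_antisymm
    · intro p hp
      obtain ⟨hhom, hv⟩ := (hmem p).1 hp
      obtain ⟨a, b, c, d, e, f, g, h, i, j, rfl⟩ := hhom.exists_ternary_cubic
      rw [hpts] at hv
      simp only [Fin.forall_fin_succ, IsEmpty.forall_iff, and_true] at hv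
      simp at hv
      obtain ⟨h1, h2, h3, h4, h5, h6, h7, h8⟩ := hv
      obtain rfl : a = 0 := by linarith
      obtain rfl : f = 0 := by linarith
      obtain rfl : d = 0 := by linarith
      obtain rfl : h = 0 := by linarith
      obtain rfl : e = 0 := by linarith
      obtain rfl : j = -c := by linarith
      obtain rfl : i = -g - b := by linarith
      obtain rfl : c = -2 * (g + b) := by linarith
      rw [Submodule.mem_span_pair]
      refine ⟨-g, g + b, ?_⟩
      rw [hx₀, hx₁, smul_eq_C_mul, smul_eq_C_mul]
      simp only [map_add, map_sub, map_neg, map_mul, map_zero, map_ofNat]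
      ring
    · rw [Submodule.span_le, Set.insert_subset_iff, Set.singleton_subset_iff]
      have hX : ∀ i : Fin 3, (X i : MvPolynomial (Fin 3) ℝ).IsHomogeneous 1 :=
        fun i => isHomogeneous_X ℝ i
      refine ⟨(hmem _).2 ⟨?_, ?_⟩, (hmem _).2 ⟨?_, ?_⟩⟩
      · rw [hx₀]
        exact (((hX 0).pow 2).sub ((hX 1).pow 2)).mul (hX 1)
      · intro i
        rw [hx₀, hpts]
        fin_cases i <;> simp
      · rw [hx₁]
        have h2 : (2 * X 2 : MvPolynomial (Fin 3) ℝ).IsHomogeneous 1 := by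
          simpa only [map_ofNat] using (hX 2).C_mul 2
        exact (((hX 0).pow 2).sub ((hX 2).pow 2)).mul ((hX 1).sub h2)
      · intro i
        rw [hx₁, hpts]
        fin_cases i <;> simp
  refine ⟨hspan, ?_⟩
  have hli : LinearIndependent ℝ ![x₀, x₁] := by
    rw [LinearIndependent.pair_iff]
    intro s t hst
    have h1 := congrArg (aeval (![0, 1, 0] : Fin 3 → ℝ)) hst
    have h2 := congrArg (aeval (![0, 0, 1] : Fin 3 → ℝ)) hst
    simp [hx₀, hx₁] at h1 h2
    exact ⟨h1, h2⟩
  rw [hspan, ← Matrix.range_cons_cons_empty x₀ x₁ ![], finrank_span_eq_card hli, Fintype.card_fin]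
end

section
/- Let x₀ = (u² − v²)·v and x₁ = (u² − t²)·(v − 2t) in ℂ[u, v, t]. If (u, v, t) ∈ ℂ³ is nonzero and satisfies x₀(u, v, t) = 0 and x₁(u, v, t) = 0, then (u, v, t) is a nonzero complex scalar multiple of one of the nine vectors (1,1,1), (1,−1,1), (−1,1,1), (−1,−1,1), (2,2,1), (−2,2,1), (1,0,1), (−1,0,1), (1,0,0). -/
open MvPolynomial

/-- The common nonzero complex zeros of the cubics `x₀ = (u² − v²)v` and
`x₁ = (u² − t²)(v − 2t)` are exactly the nonzero scalar multiples of the nine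
vectors `(±1,±1,1), (2,2,1), (−2,2,1), (±1,0,1), (1,0,0)`. -/
theorem stmt_11 (x₀ x₁ : MvPolynomial (Fin 3) ℂ)
    (hx₀ : x₀ = (X 0 ^ 2 - X 1 ^ 2) * X 1)
    (hx₁ : x₁ = (X 0 ^ 2 - X 2 ^ 2) * (X 1 - 2 * X 2))
    (p : Fin 3 → ℂ) (hp : p ≠ 0)
    (h₀ : MvPolynomial.eval p x₀ = 0) (h₁ : MvPolynomial.eval p x₁ = 0) :
    ∃ (c : ℂ) (i : Fin 9), c ≠ 0 ∧
      p = c • (![![1, 1, 1], ![1, -1, 1], ![-1, 1, 1], ![-1, -1, 1],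
        ![2, 2, 1], ![-2, 2, 1], ![1, 0, 1], ![-1, 0, 1], ![1, 0, 0]] :
          Fin 9 → (Fin 3 → ℂ)) i := by
  obtain ⟨u, v, t, rfl⟩ : ∃ u v t : ℂ, p = ![u, v, t] :=
    ⟨p 0, p 1, p 2, by ext i; fin_cases i <;> rfl⟩
  subst hx₀ hx₁
  have hX₀ : (u - v) * (u + v) * v = 0 := by
    simp at h₀
    grind
  have hX₁ : (u - t) * (u + t) * (v - 2 * t) = 0 := by
    simp at h₁
    grind
  rw [mul_eq_zero, mul_eq_zero] at hX₀ hX₁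
  by_cases ht : t = 0
  · subst ht
    have hv : v = 0 := by grind
    subst hv
    refine ⟨u, 8, fun hu => hp ?_, ?_⟩
    · simp [hu]
    · simp
  · suffices h : u = t ∧ v = t ∨ u = t ∧ v = -t ∨ u = -t ∧ v = t ∨ u = -t ∧ v = -t ∨
        u = 2 * t ∧ v = 2 * t ∨ u = -(2 * t) ∧ v = 2 * t ∨ u = t ∧ v = 0 ∨ u = -t ∧ v = 0 by
      refine ⟨t, ?_⟩
      rcases h with ⟨rfl, rfl⟩ | ⟨rfl, rfl⟩ | ⟨rfl, rfl⟩ | ⟨rfl, rfl⟩ | ⟨rfl, rfl⟩ |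
        ⟨rfl, rfl⟩ | ⟨rfl, rfl⟩ | ⟨rfl, rfl⟩
      · exact ⟨0, ht, by simp⟩
      · exact ⟨1, ht, by simp⟩
      · exact ⟨2, ht, by simp⟩
      · exact ⟨3, ht, by simp⟩
      · exact ⟨4, ht, by simp [mul_comm]⟩
      · exact ⟨5, ht, by simp [mul_comm]⟩
      · exact ⟨6, ht, by simp⟩
      · exact ⟨7, ht, by simp⟩
    rcases hX₀ with (h | h) | h <;> rcases hX₁ with (h' | h') | h' <;> grind
end

section
/- Consider the eight points P₁ = (1,1,1), P₂ = (1,−1,1), P₃ = (−1,1,1), P₄ = (−1,−1,1), P₅ = (2,2,1), P₆ = (−2,2,1), P₇ = (1,0,1), P₈ = (−1,0,1) in ℝ³, the homogeneous cubic polynomials x₀ = (u² − v²)·v and x₁ = (u² − t²)·(v − 2t), and the homogeneous sextic polynomial y₂ = (u² − v²)·(u² − t²)·((2t + v)² − 4u²) in ℝ[u, v, t]. Then: (i) y₂ and all three first partial derivatives ∂y₂/∂u, ∂y₂/∂v, ∂y₂/∂t vanish at each of the eight points Pᵢ; (ii) y₂(1, 0, 0) = −4 ≠ 0; and consequently (iii)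 y₂ is not an ℝ-linear combination of x₀², x₀x₁ and x₁². -/
open MvPolynomial

/-- If two of the three factors of a product vanish at a point, then so do the product and
all of its first partial derivatives. -/
theorem eval_mul_mul_eq_zero_and_eval_pderiv_eq_zero {σ R : Type*} [CommRing R]
    (p : σ → R) (f g h : MvPolynomial σ R)
    (H : (eval p f = 0 ∧ eval p g = 0) ∨ (eval p f = 0 ∧ eval p h = 0) ∨
      (eval p g = 0 ∧ eval p h = 0)) :
    eval p (f * g * h) = 0 ∧ ∀ j, eval p (pderiv j (f * g * h)) = 0 := by
  rcases H with ⟨h₁, h₂⟩ | ⟨h₁, h₂⟩ | ⟨h₁, h₂⟩ <;>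
    simp [Derivation.leibniz, h₁, h₂]

/-- A polynomial in the span of a set of polynomials vanishing at `p` vanishes at `p`. -/
theorem eval_eq_zero_of_mem_span {σ R : Type*} [CommRing R] (p : σ → R)
    {S : Set (MvPolynomial σ R)} (hS : ∀ f ∈ S, eval p f = 0)
    {f : MvPolynomial σ R} (hf : f ∈ Submodule.span R S) : eval p f = 0 := by
  have hle : Submodule.span R S ≤ LinearMap.ker (aeval (R := R) p).toLinearMap :=
    Submodule.span_le.mpr fun g hg => by
      simpa [aeval_eq_eval] using hS g hg
  simpa [aeval_eq_eval] using hle hf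

/-- The sextic `y₂ = (u² − v²)(u² − t²)((2t + v)² − 4u²)` vanishes doubly (together
with its first partial derivatives) at the eight points, takes the value `−4 ≠ 0`
at `(1,0,0)`, and hence is not a linear combination of `x₀², x₀x₁, x₁²`. -/
theorem stmt_12 (pts : Fin 8 → (Fin 3 → ℝ))
    (hpts : pts = ![![1, 1, 1], ![1, -1, 1], ![-1, 1, 1], ![-1, -1, 1],
      ![2, 2, 1], ![-2, 2, 1], ![1, 0, 1], ![-1, 0, 1]])
    (x₀ x₁ y₂ : MvPolynomial (Fin 3) ℝ)
    (hx₀ : x₀ = (X 0 ^ 2 - X 1 ^ 2) * X 1)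
    (hx₁ : x₁ = (X 0 ^ 2 - X 2 ^ 2) * (X 1 - 2 * X 2))
    (hy₂ : y₂ = (X 0 ^ 2 - X 1 ^ 2) * (X 0 ^ 2 - X 2 ^ 2)
      * ((2 * X 2 + X 1) ^ 2 - 4 * X 0 ^ 2)) :
    (∀ i : Fin 8, MvPolynomial.eval (pts i) y₂ = 0
        ∧ ∀ j : Fin 3, MvPolynomial.eval (pts i) (MvPolynomial.pderiv j y₂) = 0)
    ∧ (MvPolynomial.eval ![1, 0, 0] y₂ = -4 ∧ MvPolynomial.eval ![1, 0, 0] y₂ ≠ 0)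
    ∧ y₂ ∉ Submodule.span ℝ ({x₀ ^ 2, x₀ * x₁, x₁ ^ 2} :
        Set (MvPolynomial (Fin 3) ℝ)) := by
  subst hpts hx₀ hx₁ hy₂
  have hval : eval ![(1 : ℝ), 0, 0] ((X 0 ^ 2 - X 1 ^ 2) * (X 0 ^ 2 - X 2 ^ 2)
      * ((2 * X 2 + X 1) ^ 2 - 4 * X 0 ^ 2)) = -4 := by simp
  have hne : eval ![(1 : ℝ), 0, 0] ((X 0 ^ 2 - X 1 ^ 2) * (X 0 ^ 2 - X 2 ^ 2)
      * ((2 * X 2 + X 1) ^ 2 - 4 * X 0 ^ 2)) ≠ 0 := by rw [hval]; norm_num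
  refine ⟨fun i => eval_mul_mul_eq_zero_and_eval_pderiv_eq_zero _ _ _ _ ?_, ⟨hval, hne⟩,
    fun hmem => hne (eval_eq_zero_of_mem_span _ ?_ hmem)⟩
  · fin_cases i <;> simp <;> norm_num
  · rintro f (rfl | rfl | rfl) <;> simp
end

section
/- Consider the six points (1,1,1), (−1,1,1), (2,2,1), (−2,2,1), (1,0,1), (−1,0,1) in ℝ³ and the six points (1,−1,1), (−1,−1,1), (2,2,1), (−2,2,1), (1,0,1), (−1,0,1) in ℝ³. The ℝ-vector space of homogeneous polynomials of degree 2 in ℝ[u, v, t] vanishing at all six points of the first set is one-dimensional, spanned by D = −2(u² − t²) + 3v(v − t); and the ℝ-vector space of homogeneous polynomials of degree 2 in ℝ[u, v, t] vanishing at all six points of the second set is one-dimensional, spanned by D' = −2(u² − t²) + v(v + t). -/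
open MvPolynomial

/-- The ternary quadratic form with the given coefficients. -/
noncomputable def ternaryQuadric (a b c d e f : ℝ) : MvPolynomial (Fin 3) ℝ :=
  C a * X 0 ^ 2 + C b * X 1 ^ 2 + C c * X 2 ^ 2 + C d * (X 0 * X 1) + C e * (X 0 * X 2) +
    C f * (X 1 * X 2)

theorem aeval_ternaryQuadric (a b c d e f x y z : ℝ) :
    aeval ![x, y, z] (ternaryQuadric a b c d e f) =
      a * x ^ 2 + b * y ^ 2 + c * z ^ 2 + d * (x * y) + e * (x * z) + f * (y * z) := by
  simp [ternaryQuadric]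

theorem isHomogeneous_ternaryQuadric (a b c d e f : ℝ) :
    (ternaryQuadric a b c d e f).IsHomogeneous 2 := by
  have hsq (r : ℝ) (i : Fin 3) : (C r * X i ^ 2 : MvPolynomial (Fin 3) ℝ).IsHomogeneous 2 :=
    (isHomogeneous_X_pow i 2).C_mul r
  have hmul (r : ℝ) (i j : Fin 3) :
      (C r * (X i * X j) : MvPolynomial (Fin 3) ℝ).IsHomogeneous 2 :=
    ((isHomogeneous_X ℝ i).mul (isHomogeneous_X ℝ j)).C_mul r
  exact (((((hsq a 0).add (hsq b 1)).add (hsq c 2)).add (hmul d 0 1)).add (hmul e 0 2)).add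
    (hmul f 1 2)

theorem exists_eq_ternaryQuadric {p : MvPolynomial (Fin 3) ℝ} (hp : p.IsHomogeneous 2) :
    ∃ a b c d e f, p = ternaryQuadric a b c d e f := by
  rw [p.as_sum]
  refine Finset.sum_induction _ (fun q => ∃ a b c d e f, q = ternaryQuadric a b c d e f) ?_ ?_ ?_
  · rintro _ _ ⟨a, b, c, d, e, f, rfl⟩ ⟨a', b', c', d', e', f', rfl⟩
    refine ⟨a + a', b + b', c + c', d + d', e + e', f + f', ?_⟩
    simp only [ternaryQuadric, C_add]
    ring
  · exact ⟨0, 0, 0, 0, 0, 0, by simp [ternaryQuadric]⟩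
  · intro m hm
    have hdeg : m 0 + m 1 + m 2 = 2 := by
      have h := hp.degree_eq_sum_deg_support hm
      rw [← Finsupp.degree_apply, Finsupp.degree_eq_sum, Fin.sum_univ_three] at h
      exact h.symm
    rw [monomial_eq, Finsupp.prod_fintype _ _ (fun _ => pow_zero _), Fin.prod_univ_three]
    generalize coeff m p = r
    obtain ⟨h0, h1, h2⟩ | ⟨h0, h1, h2⟩ | ⟨h0, h1, h2⟩ | ⟨h0, h1, h2⟩ | ⟨h0, h1, h2⟩ |
        ⟨h0, h1, h2⟩ : (m 0 = 2 ∧ m 1 = 0 ∧ m 2 = 0) ∨ (m 0 = 0 ∧ m 1 = 2 ∧ m 2 = 0) ∨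
        (m 0 = 0 ∧ m 1 = 0 ∧ m 2 = 2) ∨ (m 0 = 1 ∧ m 1 = 1 ∧ m 2 = 0) ∨
        (m 0 = 1 ∧ m 1 = 0 ∧ m 2 = 1) ∨ (m 0 = 0 ∧ m 1 = 1 ∧ m 2 = 1) := by lia
    · exact ⟨r, 0, 0, 0, 0, 0, by simp [ternaryQuadric, h0, h1, h2]⟩
    · exact ⟨0, r, 0, 0, 0, 0, by simp [ternaryQuadric, h0, h1, h2]⟩
    · exact ⟨0, 0, r, 0, 0, 0, by simp [ternaryQuadric, h0, h1, h2]⟩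
    · exact ⟨0, 0, 0, r, 0, 0, by simp [ternaryQuadric, h0, h1, h2]⟩
    · exact ⟨0, 0, 0, 0, r, 0, by simp [ternaryQuadric, h0, h1, h2]⟩
    · exact ⟨0, 0, 0, 0, 0, r, by simp [ternaryQuadric, h0, h1, h2]⟩

theorem smul_ternaryQuadric (r a b c d e f : ℝ) :
    r • ternaryQuadric a b c d e f =
      ternaryQuadric (r * a) (r * b) (r * c) (r * d) (r * e) (r * f) := by
  simp only [ternaryQuadric, smul_eq_C_mul, C_mul]
  ring

theorem eq_span_singleton_and_finrank_eq_one {K V : Type*} [Field K] [AddCommGroup V]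
    [Module K V] {W : Submodule K V} {v : V} (hv : v ≠ 0) (hvW : v ∈ W)
    (h : ∀ w ∈ W, ∃ r : K, r • v = w) :
    W = Submodule.span K {v} ∧ Module.finrank K W = 1 := by
  have hW : W = Submodule.span K {v} :=
    le_antisymm (fun w hw => Submodule.mem_span_singleton.2 (h w hw))
      ((Submodule.span_singleton_le_iff_mem v W).2 hvW)
  exact ⟨hW, hW ▸ finrank_span_singleton hv⟩

/-- The space of homogeneous quadrics in `ℝ[u,v,t]` through the six points
`(1,1,1), (−1,1,1), (2,2,1), (−2,2,1), (1,0,1), (−1,0,1)` is one-dimensional, spanned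
by `D = −2(u² − t²) + 3v(v − t)`; and the space of homogeneous quadrics through the six
points `(1,−1,1), (−1,−1,1), (2,2,1), (−2,2,1), (1,0,1), (−1,0,1)` is one-dimensional,
spanned by `D' = −2(u² − t²) + v(v + t)`. -/
theorem stmt_14 (pts pts' : Fin 6 → (Fin 3 → ℝ))
    (hpts : pts = ![![1, 1, 1], ![-1, 1, 1], ![2, 2, 1], ![-2, 2, 1],
      ![1, 0, 1], ![-1, 0, 1]])
    (hpts' : pts' = ![![1, -1, 1], ![-1, -1, 1], ![2, 2, 1], ![-2, 2, 1],
      ![1, 0, 1], ![-1, 0, 1]])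
    (D D' : MvPolynomial (Fin 3) ℝ)
    (hD : D = -2 * (X 0 ^ 2 - X 2 ^ 2) + 3 * X 1 * (X 1 - X 2))
    (hD' : D' = -2 * (X 0 ^ 2 - X 2 ^ 2) + X 1 * (X 1 + X 2))
    (W W' : Submodule ℝ (MvPolynomial (Fin 3) ℝ))
    (hW : W = homogeneousSubmodule (Fin 3) ℝ 2 ⊓
      ⨅ i : Fin 6, LinearMap.ker (MvPolynomial.aeval (pts i)).toLinearMap)
    (hW' : W' = homogeneousSubmodule (Fin 3) ℝ 2 ⊓
      ⨅ i : Fin 6, LinearMap.ker (MvPolynomial.aeval (pts' i)).toLinearMap) :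
    (W = Submodule.span ℝ ({D} : Set (MvPolynomial (Fin 3) ℝ))
        ∧ Module.finrank ℝ W = 1)
    ∧ (W' = Submodule.span ℝ ({D'} : Set (MvPolynomial (Fin 3) ℝ))
        ∧ Module.finrank ℝ W' = 1) := by
  subst hpts hpts' hW hW'
  have hDq : D = ternaryQuadric (-2) 3 2 0 0 (-3) := by
    rw [hD]
    simp only [ternaryQuadric, map_neg, map_zero, map_ofNat]
    ring
  have hD'q : D' = ternaryQuadric (-2) 1 2 0 0 1 := by
    rw [hD']
    simp only [ternaryQuadric, map_neg, map_zero, map_one, map_ofNat]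
    ring
  constructor
  · rw [hDq]
    refine eq_span_singleton_and_finrank_eq_one ?_ ?_ ?_
    · intro h
      have h2 := congrArg (aeval (![0, 0, 1] : Fin 3 → ℝ)) h
      simp [aeval_ternaryQuadric] at h2
    · refine ⟨isHomogeneous_ternaryQuadric .., ?_⟩
      simp only [SetLike.mem_coe, Submodule.mem_iInf, LinearMap.mem_ker,
        AlgHom.toLinearMap_apply, Fin.forall_fin_succ, Matrix.cons_val_zero,
        Matrix.cons_val_succ, aeval_ternaryQuadric]
      norm_num
    · rintro p ⟨hp, hpv⟩
      obtain ⟨a, b, c, d, e, f, rfl⟩ := exists_eq_ternaryQuadric hp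
      simp only [SetLike.mem_coe, Submodule.mem_iInf, LinearMap.mem_ker,
        AlgHom.toLinearMap_apply, Fin.forall_fin_succ, Matrix.cons_val_zero,
        Matrix.cons_val_succ, aeval_ternaryQuadric] at hpv
      obtain ⟨h0, h1, h2, h3, h4, h5, -⟩ := hpv
      refine ⟨b / 3, ?_⟩
      rw [smul_ternaryQuadric]
      congr 1 <;> linarith
  · rw [hD'q]
    refine eq_span_singleton_and_finrank_eq_one ?_ ?_ ?_
    · intro h
      have h2 := congrArg (aeval (![0, 0, 1] : Fin 3 → ℝ)) h
      simp [aeval_ternaryQuadric] at h2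
    · refine ⟨isHomogeneous_ternaryQuadric .., ?_⟩
      simp only [SetLike.mem_coe, Submodule.mem_iInf, LinearMap.mem_ker,
        AlgHom.toLinearMap_apply, Fin.forall_fin_succ, Matrix.cons_val_zero,
        Matrix.cons_val_succ, aeval_ternaryQuadric]
      norm_num
    · rintro p ⟨hp, hpv⟩
      obtain ⟨a, b, c, d, e, f, rfl⟩ := exists_eq_ternaryQuadric hp
      simp only [SetLike.mem_coe, Submodule.mem_iInf, LinearMap.mem_ker,
        AlgHom.toLinearMap_apply, Fin.forall_fin_succ, Matrix.cons_val_zero,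
        Matrix.cons_val_succ, aeval_ternaryQuadric] at hpv
      obtain ⟨h0, h1, h2, h3, h4, h5, -⟩ := hpv
      refine ⟨b, ?_⟩
      rw [smul_ternaryQuadric]
      congr 1 <;> linarith
end
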